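/- Let D be an almost Dedekind domain with nonzero Jacobson radical such that Crit(D) = Max(D) (equivalently, no nonzero proper finitely generated ideal of D is bounded). Let I ⊆ Jac(D) be a nonzero finitely generated ideal. Then, for every n ∈ ℕ, the set Y_n := {M ∈ Max(D) : v_M(I) > n} is dense in Max(D) with respect to the constructible topology. -/

import Mathlib

/-!
Common definitions: almost Dedekind domains, ideal functions, critical ideals,
the constructible topology on the maximal spectrum.
-/

open scoped Classical Topology

namespace ADPaper

variable (R : Type*) [CommRing R]

/-- The normalized valuation `v_M(x)` of an element `x` of `R` in the localization at the
maximal ideal `M`: the largest `n` such that the image of `x` lies in the `n`-th power of the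
maximal ideal of `R_M` (a junk value if no largest such `n` exists). -/
noncomputable def elemVal (M : MaximalSpectrum R) (x : R) : ℕ :=
  sSup {n : ℕ | algebraMap R (Localization.AtPrime M.asIdeal) x ∈
    IsLocalRing.maximalIdeal (Localization.AtPrime M.asIdeal) ^ n}

/-- The ideal function `ν_I(M) = v_M(I) = min { v_M(x) : x ∈ I, x ≠ 0 }`. -/
noncomputable def nu (I : Ideal R) (M : MaximalSpectrum R) : ℕ :=
  sInf (elemVal R M '' {x | x ∈ I ∧ x ≠ 0})

/-- `R` is an almost Dedekind domain: the localization at every maximal ideal is a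
discrete valuation ring. (The requirement that `R` is not a field is stated separately
where needed.) -/
def AlmostDedekind [IsDomain R] : Prop :=
  ∀ M : MaximalSpectrum R, IsDiscreteValuationRing (Localization.AtPrime M.asIdeal)

/-- An ideal `M` of a commutative ring is critical if it is maximal and contains no nonzero
finitely generated radical ideal. -/
def IsCritical (M : Ideal R) : Prop :=
  M.IsMaximal ∧ ∀ J : Ideal R, J ≠ ⊥ → J.FG → J.IsRadical → ¬ J ≤ M

/-- `Crit R`: the set of critical maximal ideals, i.e. maximal ideals containing no
nonzero finitely generated radical ideal. -/
def Crit : Set (MaximalSpectrum R) :=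
  {M | ∀ J : Ideal R, J ≠ ⊥ → J.FG → J.IsRadical → ¬ J ≤ M.asIdeal}

/-- `CritN R n`: the set of `n`-critical maximal ideals, i.e. maximal ideals containing no
nonzero finitely generated ideal whose ideal function is bounded by `n`. -/
def CritN (n : ℕ) : Set (MaximalSpectrum R) :=
  {M | ∀ J : Ideal R, J ≠ ⊥ → J.FG → (∀ N, nu R J N ≤ n) → ¬ J ≤ M.asIdeal}

/-- `CritOmega R`: the set of `ω`-critical maximal ideals, i.e. maximal ideals containing no
nonzero finitely generated ideal whose ideal function is bounded. -/
def CritOmega : Set (MaximalSpectrum R) :=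
  {M | ∀ J : Ideal R, J ≠ ⊥ → J.FG → (∃ n : ℕ, ∀ N, nu R J N ≤ n) → ¬ J ≤ M.asIdeal}

/-- The constructible topology on the maximal spectrum: generated by the sets
`V(J) = {M | J ≤ M}` and their complements, for `J` finitely generated. -/
def constrTop : TopologicalSpace (MaximalSpectrum R) :=
  TopologicalSpace.generateFrom
    {S | ∃ J : Ideal R, J.FG ∧ (S = {M | J ≤ M.asIdeal} ∨ S = {M | ¬ J ≤ M.asIdeal})}

variable [IsDomain R]

/-- The localization `R_M` regarded as a subalgebra of the fraction field. -/
noncomputable def locSubalgebra (M : MaximalSpectrum R) : Subalgebra R (FractionRing R) :=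
  Localization.subalgebra (FractionRing R) M.asIdeal.primeCompl
    (fun _s hs => mem_nonZeroDivisors_of_ne_zero fun h => hs (h ▸ M.asIdeal.zero_mem))

/-- The overring `⋂ {R_M : M ∈ X}` of `R` inside the fraction field (equal to the whole
fraction field when `X = ∅`). -/
noncomputable def interLoc (X : Set (MaximalSpectrum R)) : Subalgebra R (FractionRing R) :=
  ⨅ M ∈ X, locSubalgebra R M

/-- The valuation `v_M` extended to the fraction field: `v_M(a/s) = v_M(a) - v_M(s)`. -/
noncomputable def elemValK (M : MaximalSpectrum R) (x : FractionRing R) : ℤ :=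
  (elemVal R M (IsLocalization.sec (nonZeroDivisors R) x).1 : ℤ) -
    (elemVal R M ((IsLocalization.sec (nonZeroDivisors R) x).2 : R) : ℤ)

/-- The ideal function of a fractional ideal. -/
noncomputable def nuK (I : FractionalIdeal (nonZeroDivisors R) (FractionRing R))
    (M : MaximalSpectrum R) : ℤ :=
  sInf (elemValK R M '' {x | x ∈ I ∧ x ≠ 0})

end ADPaper

namespace ADPaper

open IsLocalRing

section

variable {R : Type*} [CommRing R]

lemma algebraMap_mem_maximalIdeal_iff (M : MaximalSpectrum R) (x : R) :
    algebraMap R (Localization.AtPrime M.asIdeal) x ∈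
      maximalIdeal (Localization.AtPrime M.asIdeal) ↔ x ∈ M.asIdeal :=
  IsLocalization.AtPrime.to_map_mem_maximal_iff _ M.asIdeal x

/-- Divisibility of a finitely generated ideal by an element of the localization at `M`
spreads out to a basic open neighbourhood of `M`. -/
lemma exists_notMem_forall_mul_mem_span (M : MaximalSpectrum R) (y : R) {I : Ideal R}
    (hfg : I.FG)
    (h : ∀ b ∈ I, algebraMap R (Localization.AtPrime M.asIdeal) y ∣ algebraMap R _ b) :
    ∃ s ∉ M.asIdeal, ∀ b ∈ I, s * b ∈ Ideal.span {y} := by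
  induction I, hfg using Submodule.fg_induction with
  | singleton b =>
    obtain ⟨z, hz⟩ := h b (Submodule.mem_span_singleton_self b)
    obtain ⟨r, u, rfl⟩ := IsLocalization.exists_mk'_eq M.asIdeal.primeCompl z
    rw [← IsLocalization.mk'_one (M := M.asIdeal.primeCompl) _ y, ← IsLocalization.mk'_mul,
      ← IsLocalization.mk'_one (M := M.asIdeal.primeCompl) _ b, IsLocalization.mk'_eq_iff_eq,
      IsLocalization.eq_iff_exists M.asIdeal.primeCompl] at hz
    obtain ⟨c, hc⟩ := hz
    refine ⟨c * u, (c * u).2, fun b' hb' => ?_⟩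
    obtain ⟨w, rfl⟩ := Submodule.mem_span_singleton.1 hb'
    rw [Ideal.mem_span_singleton]
    refine ⟨c * r * w, ?_⟩
    simp only [Submonoid.coe_one, one_mul, smul_eq_mul] at hc ⊢
    linear_combination w * hc
  | sup I₁ I₂ _ _ ih₁ ih₂ =>
    obtain ⟨s, hs, h₁⟩ := ih₁ fun b hb => h b (Ideal.mem_sup_left hb)
    obtain ⟨t, ht, h₂⟩ := ih₂ fun b hb => h b (Ideal.mem_sup_right hb)
    refine ⟨s * t, fun hst => (M.isMaximal.isPrime.mem_or_mem hst).elim hs ht, fun b hb => ?_⟩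
    obtain ⟨b₁, hb₁, b₂, hb₂, rfl⟩ := Submodule.mem_sup.1 hb
    have e : s * t * (b₁ + b₂) = t * (s * b₁) + s * (t * b₂) := by ring
    rw [e]
    exact add_mem (Ideal.mul_mem_left _ _ (h₁ _ hb₁)) (Ideal.mul_mem_left _ _ (h₂ _ hb₂))

variable [IsDomain R]

lemma AlmostDedekind.isMaximal_of_isPrime (hAD : AlmostDedekind R) {P : Ideal R}
    (hP : P.IsPrime) (h0 : P ≠ ⊥) : P.IsMaximal := by
  obtain ⟨N, hN, hPN⟩ := P.exists_le_maximal hP.ne_top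
  have := hAD ⟨N, hN⟩
  have hdisj : Disjoint (N.primeCompl : Set R) (P : Set R) :=
    Set.disjoint_left.2 fun x hx hxP => hx (hPN hxP)
  have hprime := IsLocalization.isPrime_of_isPrime_disjoint N.primeCompl
    (Localization.AtPrime N) P hP hdisj
  have hcomap := IsLocalization.under_map_of_isPrime_disjoint N.primeCompl
    (Localization.AtPrime N) hP hdisj
  have hne : P.map (algebraMap R (Localization.AtPrime N)) ≠ ⊥ := by
    intro h
    rw [h, Ideal.under_def, ← RingHom.ker_eq_comap_bot, (RingHom.injective_iff_ker_eq_bot _).1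
      (IsLocalization.injective _ N.primeCompl_le_nonZeroDivisors)] at hcomap
    exact h0 hcomap.symm
  have hmax := eq_maximalIdeal (hprime.isMaximal hne)
  rw [hmax] at hcomap
  rwa [← hcomap.symm.trans (IsLocalization.AtPrime.under_maximalIdeal _ N)] at hN

/-- If the Jacobson radical is nonzero, then every basic open neighbourhood of `M` contains a
principal closed one. -/
lemma AlmostDedekind.exists_mem_forall_notMem (hAD : AlmostDedekind R)
    (hJ : Ideal.jacobson (⊥ : Ideal R) ≠ ⊥) (M : MaximalSpectrum R) {s : R}
    (hs : s ∉ M.asIdeal) :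
    ∃ t ∈ M.asIdeal, ∀ N : MaximalSpectrum R, t ∈ N.asIdeal → s ∉ N.asIdeal := by
  suffices h : ∃ (i : ℕ) (b : R), s ^ i * (1 - s * b) ∈ Ideal.jacobson (⊥ : Ideal R) by
    obtain ⟨i, b, h⟩ := h
    refine ⟨1 - s * b, ?_, fun N ht hsN => N.isMaximal.ne_top ?_⟩
    · have hM := (Ideal.mem_sInf.1 h) ⟨bot_le, M.isMaximal⟩
      exact (M.isMaximal.isPrime.mem_or_mem hM).resolve_left
        fun h => hs (M.isMaximal.isPrime.mem_of_pow_mem _ h)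
    · rw [Ideal.eq_top_iff_one]
      have := add_mem ht (N.asIdeal.mul_mem_right b hsN)
      simpa using this
  by_contra! hcon
  let S : Submonoid R :=
    { carrier := {z | ∃ (i : ℕ) (b : R), z = s ^ i * (1 - s * b)}
      one_mem' := ⟨0, 0, by simp⟩
      mul_mem' := by
        rintro _ _ ⟨i, b, rfl⟩ ⟨j, c, rfl⟩
        exact ⟨i + j, b + c - s * b * c, by ring⟩ }
  obtain ⟨P, hP, hJP, hPS⟩ := Ideal.exists_le_prime_disjoint (Ideal.jacobson (⊥ : Ideal R)) S
    (Set.disjoint_left.2 fun z hz hzS => by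
      obtain ⟨i, b, rfl⟩ := hzS
      exact hcon i b hz)
  have hmax := hAD.isMaximal_of_isPrime hP fun h => hJ (le_bot_iff.1 (h ▸ hJP))
  have hsP : s ∉ P := fun h => Set.disjoint_left.1 hPS h ⟨1, 0, by simp⟩
  obtain ⟨b, y, hy, hb⟩ := hmax.exists_inv hsP
  refine Set.disjoint_left.1 hPS hy ⟨0, b, ?_⟩
  linear_combination hb

/-- If the Jacobson radical is nonzero, then the sets `V(J)`, with `J` finitely generated, form
a basis of the constructible topology. -/
lemma AlmostDedekind.exists_fg_of_isOpen (hAD : AlmostDedekind R)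
    (hJ : Ideal.jacobson (⊥ : Ideal R) ≠ ⊥) {U : Set (MaximalSpectrum R)}
    (hU : IsOpen[constrTop R] U) {M : MaximalSpectrum R} (hM : M ∈ U) :
    ∃ J : Ideal R, J.FG ∧ J ≤ M.asIdeal ∧ {N : MaximalSpectrum R | J ≤ N.asIdeal} ⊆ U := by
  induction hU with
  | basic S hS =>
    obtain ⟨J, hJfg, rfl | rfl⟩ := hS
    · exact ⟨J, hJfg, hM, subset_rfl⟩
    · obtain ⟨s, hsJ, hs⟩ := SetLike.not_le_iff_exists.1 hM
      obtain ⟨t, ht, h⟩ := hAD.exists_mem_forall_notMem hJ M hs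
      refine ⟨Ideal.span {t}, Submodule.fg_span_singleton t, ?_, fun N hN hJN => ?_⟩
      · rwa [Ideal.span_singleton_le_iff_mem]
      · exact h N ((Ideal.span_singleton_le_iff_mem _).1 hN) (hJN hsJ)
  | univ => exact ⟨⊥, Submodule.fg_bot, bot_le, Set.subset_univ _⟩
  | inter S T _ _ ihS ihT =>
    obtain ⟨J, hJfg, hJM, hJS⟩ := ihS hM.1
    obtain ⟨K, hKfg, hKM, hKT⟩ := ihT hM.2
    exact ⟨J ⊔ K, Submodule.FG.sup hJfg hKfg, sup_le hJM hKM,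
      fun N (hN : J ⊔ K ≤ N.asIdeal) =>
        ⟨hJS (le_sup_left.trans hN : J ≤ _), hKT (le_sup_right.trans hN : K ≤ _)⟩⟩
  | sUnion S _ ih =>
    obtain ⟨T, hTS, hMT⟩ := hM
    obtain ⟨J, hJfg, hJM, hJT⟩ := ih T hTS hMT
    exact ⟨J, hJfg, hJM, hJT.trans (Set.subset_sUnion_of_mem hTS)⟩

lemma AlmostDedekind.le_elemVal_iff (hAD : AlmostDedekind R) (M : MaximalSpectrum R) {x : R}
    (hx : x ≠ 0) (k : ℕ) :
    k ≤ elemVal R M x ↔ algebraMap R (Localization.AtPrime M.asIdeal) x ∈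
      maximalIdeal (Localization.AtPrime M.asIdeal) ^ k := by
  have := hAD M
  have hinj := IsLocalization.injective (Localization.AtPrime M.asIdeal)
    M.asIdeal.primeCompl_le_nonZeroDivisors
  have hbdd : BddAbove {n : ℕ | algebraMap R (Localization.AtPrime M.asIdeal) x ∈
      maximalIdeal (Localization.AtPrime M.asIdeal) ^ n} := by
    by_contra hcon
    have hmem : algebraMap R (Localization.AtPrime M.asIdeal) x ∈
        ⨅ i : ℕ, maximalIdeal (Localization.AtPrime M.asIdeal) ^ i := by
      refine Ideal.mem_iInf.2 fun i => ?_
      obtain ⟨j, hj, hij⟩ := not_bddAbove_iff.1 hcon i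
      exact Ideal.pow_le_pow_right hij.le hj
    rw [Ideal.iInf_pow_eq_bot_of_isLocalRing _ (maximalIdeal.isMaximal _).ne_top,
      Ideal.mem_bot] at hmem
    exact hx ((map_eq_zero_iff _ hinj).1 hmem)
  refine ⟨fun h => Ideal.pow_le_pow_right h ?_, fun h => le_csSup hbdd h⟩
  exact Nat.sSup_mem ⟨0, by simp⟩ hbdd

lemma AlmostDedekind.le_nu_iff (hAD : AlmostDedekind R) (M : MaximalSpectrum R) {I : Ideal R}
    (hI : I ≠ ⊥) (k : ℕ) :
    k ≤ nu R I M ↔ ∀ x ∈ I, algebraMap R (Localization.AtPrime M.asIdeal) x ∈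
      maximalIdeal (Localization.AtPrime M.asIdeal) ^ k := by
  obtain ⟨y, hyI, hy⟩ := Submodule.exists_mem_ne_zero_of_ne_bot hI
  have hne : (elemVal R M '' {x | x ∈ I ∧ x ≠ 0}).Nonempty := ⟨_, y, ⟨hyI, hy⟩, rfl⟩
  rw [nu, le_csInf_iff (OrderBot.bddBelow _) hne, Set.forall_mem_image]
  refine ⟨fun h x hx => ?_, fun h x hx => (hAD.le_elemVal_iff M hx.2 k).2 (h x hx.1)⟩
  by_cases hx0 : x = 0
  · simp [hx0]
  · exact (hAD.le_elemVal_iff M hx0 k).1 (h ⟨hx, hx0⟩)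

end

lemma maximalIdeal_eq_span_of_notMem_sq {A : Type*} [CommRing A] [IsDomain A]
    [IsDiscreteValuationRing A] {x : A} (hx : x ∈ maximalIdeal A)
    (hx2 : x ∉ maximalIdeal A ^ 2) : maximalIdeal A = Ideal.span {x} := by
  obtain ⟨ϖ, hϖ⟩ := IsDiscreteValuationRing.exists_irreducible A
  rw [hϖ.maximalIdeal_eq] at hx hx2 ⊢
  obtain ⟨u, rfl⟩ := Ideal.mem_span_singleton.1 hx
  have hu : IsUnit u := by
    by_contra hu
    have hmem : u ∈ maximalIdeal A := (mem_maximalIdeal _).2 hu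
    rw [hϖ.maximalIdeal_eq] at hmem
    exact hx2 (pow_two (Ideal.span {ϖ}) ▸
      Ideal.mul_mem_mul (Ideal.mem_span_singleton_self ϖ) hmem)
  exact (Ideal.span_singleton_mul_right_unit hu ϖ).symm

section

variable {R : Type*} [CommRing R] [IsDomain R]

lemma AlmostDedekind.exists_mem_notMem_sq (hAD : AlmostDedekind R) (M : MaximalSpectrum R) :
    ∃ x ∈ M.asIdeal, algebraMap R (Localization.AtPrime M.asIdeal) x ∉
      maximalIdeal (Localization.AtPrime M.asIdeal) ^ 2 := by
  have := hAD M
  by_contra! hcon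
  have hle : maximalIdeal (Localization.AtPrime M.asIdeal) ≤
      maximalIdeal (Localization.AtPrime M.asIdeal) ^ 2 := by
    conv_lhs => rw [← Localization.AtPrime.map_eq_maximalIdeal]
    exact Ideal.map_le_iff_le_comap.2 hcon
  obtain ⟨ϖ, hϖ⟩ := IsDiscreteValuationRing.exists_irreducible
    (Localization.AtPrime M.asIdeal)
  rw [hϖ.maximalIdeal_eq, Ideal.span_singleton_pow, Ideal.span_singleton_le_span_singleton,
    pow_two] at hle
  exact hϖ.not_isUnit (isUnit_of_dvd_one
    ((mul_dvd_mul_iff_left hϖ.ne_zero).1 (by simpa using hle)))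

lemma AlmostDedekind.isRadical_of_forall_exists_notMem_sq (hAD : AlmostDedekind R) {A : Ideal R}
    (h : ∀ M : MaximalSpectrum R, A ≤ M.asIdeal → ∃ x ∈ A,
      algebraMap R (Localization.AtPrime M.asIdeal) x ∉
        maximalIdeal (Localization.AtPrime M.asIdeal) ^ 2) : A.IsRadical := by
  rintro y ⟨j, hj⟩
  refine Ideal.mem_of_localization_maximal fun P hP => ?_
  have := hAD ⟨P, hP⟩
  by_cases hAP : A ≤ P
  · obtain ⟨x, hxA, hx2⟩ := h ⟨P, hP⟩ hAP
    have hy := (algebraMap_mem_maximalIdeal_iff ⟨P, hP⟩ y).2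
      (hP.isPrime.mem_of_pow_mem j (hAP hj))
    rw [maximalIdeal_eq_span_of_notMem_sq
      ((algebraMap_mem_maximalIdeal_iff ⟨P, hP⟩ x).2 (hAP hxA)) hx2] at hy
    exact (Ideal.span_singleton_le_iff_mem _).2 (Ideal.mem_map_of_mem _ hxA) hy
  · obtain ⟨a, haA, haP⟩ := SetLike.not_le_iff_exists.1 hAP
    rw [Ideal.eq_top_of_isUnit_mem _ (Ideal.mem_map_of_mem _ haA)
      (IsLocalization.map_units (Localization.AtPrime P) (⟨a, haP⟩ : P.primeCompl))]
    trivial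

/-- A finitely generated ideal `J` such that `ν_I` is positive and bounded on `V(J) ≠ ∅` yields
a noncritical maximal ideal. -/
lemma AlmostDedekind.exists_notMem_crit (hAD : AlmostDedekind R)
    (hJac : Ideal.jacobson (⊥ : Ideal R) ≠ ⊥) {I J : Ideal R} (hI : I ≠ ⊥) (hfg : I.FG)
    (hIJ : I ≤ Ideal.jacobson (⊥ : Ideal R)) (hJfg : J.FG) {M₀ : MaximalSpectrum R}
    (hJM₀ : J ≤ M₀.asIdeal) {n : ℕ}
    (hn : ∀ M : MaximalSpectrum R, J ≤ M.asIdeal → nu R I M ≤ n) :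
    ∃ M : MaximalSpectrum R, M ∉ Crit R := by
  have hbdd : BddAbove (nu R I '' {M | J ≤ M.asIdeal}) :=
    ⟨n, Set.forall_mem_image.2 fun M hM => hn M hM⟩
  obtain ⟨M, hJM : J ≤ M.asIdeal, hMk⟩ := Nat.sSup_mem (Set.Nonempty.image _ ⟨M₀, hJM₀⟩) hbdd
  have hmax : ∀ N : MaximalSpectrum R, J ≤ N.asIdeal → nu R I N ≤ nu R I M :=
    fun N hN => hMk ▸ le_csSup hbdd ⟨N, hN, rfl⟩
  have hpos : 1 ≤ nu R I M := by
    refine (hAD.le_nu_iff M hI 1).2 fun x hx => ?_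
    rw [pow_one, algebraMap_mem_maximalIdeal_iff]
    exact Ideal.mem_sInf.1 (hIJ hx) ⟨bot_le, M.isMaximal⟩
  have := hAD M
  obtain ⟨x, hxM, hx2⟩ := hAD.exists_mem_notMem_sq M
  have hspan := maximalIdeal_eq_span_of_notMem_sq
    ((algebraMap_mem_maximalIdeal_iff M x).2 hxM) hx2
  obtain ⟨s, hs, hsI⟩ := exists_notMem_forall_mul_mem_span M (x ^ nu R I M) hfg fun b hb => by
    have := (hAD.le_nu_iff M hI _).1 le_rfl b hb
    rwa [hspan, Ideal.span_singleton_pow, Ideal.mem_span_singleton, ← map_pow] at this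
  obtain ⟨t, ht, hts⟩ := hAD.exists_mem_forall_notMem hJac M hs
  have hxA : x ∈ J ⊔ Ideal.span {x, t} :=
    Ideal.mem_sup_right (Ideal.subset_span (Set.mem_insert _ _))
  have htA : t ∈ J ⊔ Ideal.span {x, t} :=
    Ideal.mem_sup_right (Ideal.subset_span (Set.mem_insert_of_mem _ rfl))
  refine ⟨M, fun hM => hM (J ⊔ Ideal.span {x, t}) (fun hbot => ?_)
    (Submodule.FG.sup hJfg (Submodule.fg_span (Set.toFinite _)))
    (hAD.isRadical_of_forall_exists_notMem_sq fun N hN => ⟨x, hxA, fun hxN => ?_⟩) ?_⟩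
  · rw [hbot, Ideal.mem_bot] at hxA
    simp [hxA] at hx2
  · have hle : 2 * nu R I M ≤ nu R I N := by
      refine (hAD.le_nu_iff N hI _).2 fun b hb => ?_
      obtain ⟨r, hr⟩ := Ideal.mem_span_singleton.1 (hsI b hb)
      have hunit := IsLocalization.map_units (Localization.AtPrime N.asIdeal)
        (⟨s, hts N (hN htA)⟩ : N.asIdeal.primeCompl)
      rw [← Ideal.unit_mul_mem_iff_mem _ hunit, ← map_mul, hr, map_mul, map_pow, pow_mul]
      exact Ideal.mul_mem_right _ _ (Ideal.pow_mem_pow hxN _)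
    have := hmax N (le_sup_left.trans hN)
    omega
  · refine sup_le hJM (Ideal.span_le.2 ?_)
    rintro _ (rfl | rfl)
    exacts [hxM, ht]

end

/-- Let `D` be an almost Dedekind domain with nonzero Jacobson radical such
that `Crit(D) = Max(D)`, and let `I ⊆ Jac(D)` be a nonzero finitely generated ideal. Then
for every `n ∈ ℕ` the set `Yₙ = {M : v_M(I) > n}` is dense in `Max(D)` with the
constructible topology. -/
theorem statement9 (R : Type*) [CommRing R] [IsDomain R] (hR : ¬ IsField R)
    (hAD : AlmostDedekind R) (hJ : Ideal.jacobson (⊥ : Ideal R) ≠ ⊥)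
    (hcrit : Crit R = Set.univ) (I : Ideal R) (hI : I ≠ ⊥) (hfg : I.FG)
    (hIJ : I ≤ Ideal.jacobson (⊥ : Ideal R)) (n : ℕ) :
    @Dense (MaximalSpectrum R) (constrTop R) {M : MaximalSpectrum R | n < nu R I M} := by
  let _ := constrTop R
  refine dense_iff_inter_open.2 fun U hU ⟨M₀, hM₀⟩ => ?_
  by_contra hempty
  obtain ⟨J, hJfg, hJM₀, hJU⟩ := hAD.exists_fg_of_isOpen hJ hU hM₀
  obtain ⟨M, hM⟩ := hAD.exists_notMem_crit hJ hI hfg hIJ hJfg hJM₀ (n := n) fun M hM =>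
    not_lt.1 fun hlt => hempty ⟨M, hJU hM, hlt⟩
  exact hM (hcrit ▸ Set.mem_univ M)

end ADPaper
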